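/- arXiv:2310.17309 — 2 statements merged into one kernel-verified Lean document; each statement's English description precedes it below -/
import Mathlib

section
/- Let 𝒰 be a finite partition of Ω into disjoint rings or atoms, and let f = Σ_{U∈𝒰} f_U with f_U ∈ S_U for each U. Then |f|_{V_{σ,p}(S)} = max_{𝓡 ∈ ℛ(𝒰)} (Σ_{R∈𝓡} E_p(f,R)^σ)^{1/σ}, where ℛ(𝒰) is the set of finite families of pairwise disjoint elements of Π_𝒰. -/
open MeasureTheory ENNReal Set Filter
open scoped ENNReal NNReal Classical

noncomputable section

variable {Ω : Type} [MeasurableSpace Ω]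

/-- The data of a filtration on `Ω`, recorded through the (finitely many) atoms of each
σ-algebra `ℱ_n`. -/
structure FiltrationAtoms (Ω : Type) [MeasurableSpace Ω] (μ : Measure Ω) where
  atoms : ℕ → Set (Set Ω)
  atoms_finite : ∀ n, (atoms n).Finite
  atoms_measurable : ∀ n, ∀ A ∈ atoms n, MeasurableSet A
  atoms_zero : atoms 0 = {Set.univ}
  atoms_disjoint : ∀ n, (atoms n).Pairwise Disjoint
  atoms_cover : ∀ n, ⋃₀ atoms n = Set.univ
  atoms_pos : ∀ n, ∀ A ∈ atoms n, 0 < μ A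
  atoms_refine : ∀ n, ∀ B ∈ atoms (n + 1), ∃ A ∈ atoms n, B ⊆ A

namespace FiltrationAtoms

variable {μ : Measure Ω}

/-- The collection `𝒜` of all atoms of the filtration. -/
def Atoms (F : FiltrationAtoms Ω μ) : Set (Set Ω) := ⋃ n, F.atoms n

/-- A `ν`-ary filtration: every atom of `ℱ_n` is the union of at most `ν` atoms of `ℱ_{n+1}`. -/
def IsNuAry (F : FiltrationAtoms Ω μ) (ν : ℕ) : Prop :=
  ∀ n, ∀ A ∈ F.atoms n, ∃ T : Finset (Set Ω),
    T.card ≤ ν ∧ ↑T ⊆ F.atoms (n + 1) ∧ A = ⋃₀ ↑T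

/-- A binary filtration: in the passage from `ℱ_n` to `ℱ_{n+1}`, exactly one atom `A` is
subdivided into two atoms `A'`, `A''` of positive measure with `μ A' ≤ μ A''`. -/
def IsBinary (F : FiltrationAtoms Ω μ) : Prop :=
  ∀ n, ∃ A ∈ F.atoms n, ∃ A' A'' : Set Ω, A' ∈ F.atoms (n + 1) ∧ A'' ∈ F.atoms (n + 1) ∧
    Disjoint A' A'' ∧ A = A' ∪ A'' ∧ μ A' ≤ μ A'' ∧ 0 < μ A' ∧
    F.atoms (n + 1) = insert A' (insert A'' (F.atoms n \ {A}))

/-- `B` is one of the atoms into which the atom `A` is subdivided. -/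
def IsChildOf (F : FiltrationAtoms Ω μ) (B A : Set Ω) : Prop :=
  ∃ n, A ∈ F.atoms n ∧ B ∈ F.atoms (n + 1) ∧ B ⊂ A

/-- `R` is an atom or a (nonempty) ring, i.e. a difference `A \ B` of two nested atoms. -/
def IsAtomOrRing (F : FiltrationAtoms Ω μ) (R : Set Ω) : Prop :=
  R ∈ F.Atoms ∨ ∃ A ∈ F.Atoms, ∃ B ∈ F.Atoms, B ⊆ A ∧ R = A \ B ∧ R.Nonempty

end FiltrationAtoms

/-- The stability condition on the finite-dimensional space `S`:
there are `c₁, c₂ ∈ (0,1]` with `|{ω ∈ A : |f ω| ≥ c₁ ‖f‖_{L^∞(A)}}| ≥ c₂ |A|` for all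
`f ∈ S` and all atoms `A`. -/
def StabilityCondition {μ : Measure Ω} (F : FiltrationAtoms Ω μ)
    (S : Submodule ℝ (Ω → ℝ)) : Prop :=
  ∃ c₁ ∈ Set.Ioc (0:ℝ) 1, ∃ c₂ ∈ Set.Ioc (0:ℝ) 1,
    ∀ A ∈ F.Atoms, ∀ f ∈ S,
      ENNReal.ofReal c₂ * μ A ≤
        μ {ω | ω ∈ A ∧
          ENNReal.ofReal c₁ * eLpNormEssSup f (μ.restrict A) ≤ ENNReal.ofReal |f ω|}

/-- `E_p(f,R)`: the error of best `L^p(R)`-approximation of `f` by elements of `S` (restricted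
to `R`). -/
def Ep (S : Submodule ℝ (Ω → ℝ)) (p : ℝ) (μ : Measure Ω) (f : Ω → ℝ) (R : Set Ω) : ℝ≥0∞ :=
  ⨅ g ∈ S, eLpNorm (f - g) (ENNReal.ofReal p) (μ.restrict R)

/-- The ring-variation seminorm `|f|_{V_{σ,p}}`: the supremum of
`(∑_{R ∈ P} E_p(f,R)^σ)^{1/σ}` over all finite collections `P` of pairwise disjoint atoms
or rings. -/
def varSeminorm {μ : Measure Ω} (F : FiltrationAtoms Ω μ)
    (S : Submodule ℝ (Ω → ℝ)) (σ p : ℝ) (f : Ω → ℝ) : ℝ≥0∞ :=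
  ⨆ (P : Finset (Set Ω)) (_ : ∀ R ∈ P, F.IsAtomOrRing R)
    (_ : (↑P : Set (Set Ω)).Pairwise Disjoint),
    (∑ R ∈ P, Ep S p μ f R ^ σ) ^ (1 / σ)

/-- The full variation norm `‖f‖_{V_{σ,p}} = ‖f‖_p + |f|_{V_{σ,p}}`. -/
def varNorm {μ : Measure Ω} (F : FiltrationAtoms Ω μ)
    (S : Submodule ℝ (Ω → ℝ)) (σ p : ℝ) (f : Ω → ℝ) : ℝ≥0∞ :=
  eLpNorm f (ENNReal.ofReal p) μ + varSeminorm F S σ p f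

/-- The dictionary `𝒞 = {g·1_A : g ∈ S, A ∈ 𝒜}`. -/
def dictC {μ : Measure Ω} (F : FiltrationAtoms Ω μ) (S : Submodule ℝ (Ω → ℝ)) :
    Set (Ω → ℝ) :=
  {h | ∃ g ∈ S, ∃ A ∈ F.Atoms, h = A.indicator g}

/-- `Σ_n^D`: linear combinations of at most `n` elements of the dictionary `D`. -/
def SigmaN (D : Set (Ω → ℝ)) (n : ℕ) : Set (Ω → ℝ) :=
  {h | ∃ c : Fin n → ℝ, ∃ x : Fin n → Ω → ℝ, (∀ j, x j ∈ D) ∧ h = ∑ j, c j • x j}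

/-- `σ_n(f, D)`: the error of best `n`-term approximation in `L^p` with respect to the
dictionary `D`. -/
def bestApprox (D : Set (Ω → ℝ)) (p : ℝ) (μ : Measure Ω) (f : Ω → ℝ) (n : ℕ) : ℝ≥0∞ :=
  ⨅ y ∈ SigmaN D n, eLpNorm (f - y) (ENNReal.ofReal p) μ

/-- The `ℓ^q` norm (`0 < q ≤ ∞`) of a sequence of extended nonnegative reals. -/
def lqNorm (q : ℝ≥0∞) (a : ℕ → ℝ≥0∞) : ℝ≥0∞ :=
  if q = ∞ then ⨆ n, a n else (∑' n, a n ^ q.toReal) ^ (1 / q.toReal)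

/-- The quasi-norm of the approximation space `𝒜_q^α`:
`‖f‖_p + ‖(2^{nα} σ_{2^n}(f,D))_n‖_{ℓ^q}`. -/
def approxNorm (D : Set (Ω → ℝ)) (p : ℝ) (q : ℝ≥0∞) (α : ℝ) (μ : Measure Ω)
    (f : Ω → ℝ) : ℝ≥0∞ :=
  eLpNorm f (ENNReal.ofReal p) μ +
    lqNorm q (fun n => (2 : ℝ≥0∞) ^ ((n : ℝ) * α) * bestApprox D p μ f (2 ^ n))

/-- Membership in `L^p(S)`, the `L^p`-closure of the span of the dictionary `𝒞`. -/
def MemLpS {μ : Measure Ω} (F : FiltrationAtoms Ω μ) (S : Submodule ℝ (Ω → ℝ)) (p : ℝ)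
    (f : Ω → ℝ) : Prop :=
  AEMeasurable f μ ∧ eLpNorm f (ENNReal.ofReal p) μ ≠ ∞ ∧
    ∀ ε : ℝ≥0∞, 0 < ε → ∃ n, ∃ y ∈ SigmaN (dictC F S) n,
      eLpNorm (f - y) (ENNReal.ofReal p) μ < ε

/-- Membership in the variation space `V_{σ,p}(S)`. -/
def MemVar {μ : Measure Ω} (F : FiltrationAtoms Ω μ) (S : Submodule ℝ (Ω → ℝ)) (σ p : ℝ)
    (f : Ω → ℝ) : Prop :=
  MemLpS F S p f ∧ varSeminorm F S σ p f ≠ ∞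

/-- The K-functional `K(f, t, L^p, Y)` for a subset `Y` of functions with (quasi-)norm
`yNorm`. -/
def Kfun (p : ℝ) (μ : Measure Ω) (Y : Set (Ω → ℝ)) (yNorm : (Ω → ℝ) → ℝ≥0∞)
    (f : Ω → ℝ) (t : ℝ≥0∞) : ℝ≥0∞ :=
  ⨅ g ∈ Y, eLpNorm (f - g) (ENNReal.ofReal p) μ + t * yNorm g

/-- The quasi-norm of the real interpolation space `(L^p, Y)_{θ,q}`, namely
`‖(2^{nθ} K(f, 2^{-n}))_n‖_{ℓ^q}`. -/
def interpNorm (p : ℝ) (μ : Measure Ω) (Y : Set (Ω → ℝ)) (yNorm : (Ω → ℝ) → ℝ≥0∞)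
    (θ : ℝ) (q : ℝ≥0∞) (f : Ω → ℝ) : ℝ≥0∞ :=
  lqNorm q (fun n => (2 : ℝ≥0∞) ^ ((n : ℝ) * θ) *
    Kfun p μ Y yNorm f ((2 : ℝ≥0∞) ^ (-(n : ℝ))))

/-- The modulus of smoothness `𝒲_S(f,t)_{σ,p}`; the supremum ranges over all finite
partitions of `Ω` into pairwise disjoint atoms or rings. -/
def modW {μ : Measure Ω} (F : FiltrationAtoms Ω μ) (S : Submodule ℝ (Ω → ℝ)) (σ p : ℝ)
    (f : Ω → ℝ) (t : ℝ) : ℝ≥0∞ :=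
  ⨆ (P : Finset (Set Ω)) (_ : ∀ R ∈ P, F.IsAtomOrRing R)
    (_ : (↑P : Set (Set Ω)).Pairwise Disjoint) (_ : ⋃₀ (↑P : Set (Set Ω)) = Set.univ),
    min (ENNReal.ofReal t) ((P.card : ℝ≥0∞)⁻¹) ^ (1 / σ - 1 / p) *
      (∑ R ∈ P, Ep S p μ f R ^ σ) ^ (1 / σ)

/-- `h` belongs to `S(ℱ_n)`: on each atom of `ℱ_n`, `h` agrees with some element of `S`. -/
def PiecewiseS {μ : Measure Ω} (F : FiltrationAtoms Ω μ) (S : Submodule ℝ (Ω → ℝ)) (n : ℕ)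
    (h : Ω → ℝ) : Prop :=
  ∀ A ∈ F.atoms n, ∃ g ∈ S, Set.EqOn h g A

/-- The near-best approximation operator `W_μ f = ∑_{A ∈ 𝒜_μ} f_A · 1_A` built from a
selection `fA` of near-best approximants on atoms. -/
def Wop {μ : Measure Ω} (F : FiltrationAtoms Ω μ) (fA : (Ω → ℝ) → Set Ω → Ω → ℝ)
    (f : Ω → ℝ) (n : ℕ) : Ω → ℝ :=
  ∑ A ∈ (F.atoms_finite n).toFinset, A.indicator (fA f A)

end

/-- The atoms of the σ-algebra `ℱ_𝒰` generated by a finite partition `𝒰` of `Ω` into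
rings or atoms: the nonempty sets `C ∩ U` with `U ∈ 𝒰` and `C ∈ 𝒜_{m U}`, where `m U` is
the defining level of `U`. -/
def atomsU {Ω : Type} [MeasurableSpace Ω] {μ : MeasureTheory.Measure Ω}
    (F : FiltrationAtoms Ω μ) (𝒰 : Finset (Set Ω)) (m : Set Ω → ℕ) : Set (Set Ω) :=
  {X | ∃ U ∈ 𝒰, ∃ C ∈ F.atoms (m U), X = C ∩ U ∧ X.Nonempty}

/-- The collection `Π_𝒰` of all atoms or rings coarser than `𝒰`: either an atom strictly
containing an atom of `ℱ_𝒰`, or a ring `A \ B` with `A` strictly containing an atom of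
`ℱ_𝒰` and `B` containing an atom of `ℱ_𝒰`. -/
def PiU {Ω : Type} [MeasurableSpace Ω] {μ : MeasureTheory.Measure Ω}
    (F : FiltrationAtoms Ω μ) (𝒰 : Finset (Set Ω)) (m : Set Ω → ℕ) : Set (Set Ω) :=
  {X | (X ∈ F.Atoms ∧ ∃ Y ∈ atomsU F 𝒰 m, Y ⊂ X) ∨
    ∃ A ∈ F.Atoms, ∃ B ∈ F.Atoms, (∃ Y ∈ atomsU F 𝒰 m, Y ⊂ A) ∧
      (∃ Y ∈ atomsU F 𝒰 m, Y ⊆ B) ∧ X = A \ B ∧ X.Nonempty}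

namespace FiltrationAtoms

variable {Ω : Type} [MeasurableSpace Ω] {μ : Measure Ω} (F : FiltrationAtoms Ω μ)

lemma mem_Atoms {A : Set Ω} : A ∈ F.Atoms ↔ ∃ n, A ∈ F.atoms n := Set.mem_iUnion

variable {F}

lemma nonempty_of_mem_Atoms {A : Set Ω} (hA : A ∈ F.Atoms) : A.Nonempty := by
  obtain ⟨n, hn⟩ := F.mem_Atoms.1 hA
  exact nonempty_of_measure_ne_zero (F.atoms_pos n A hn).ne'

lemma exists_superset_of_le {n k : ℕ} (hnk : n ≤ k) {B : Set Ω} (hB : B ∈ F.atoms k) :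
    ∃ A ∈ F.atoms n, B ⊆ A := by
  induction k, hnk using Nat.le_induction generalizing B with
  | base => exact ⟨B, hB, Subset.rfl⟩
  | succ k _ ih =>
    obtain ⟨C, hC, hBC⟩ := F.atoms_refine k B hB
    obtain ⟨A, hA, hCA⟩ := ih hC
    exact ⟨A, hA, hBC.trans hCA⟩

lemma subset_or_disjoint_of_le {n k : ℕ} (hnk : n ≤ k) {A B : Set Ω} (hA : A ∈ F.atoms n)
    (hB : B ∈ F.atoms k) : B ⊆ A ∨ Disjoint A B := by
  obtain ⟨C, hC, hBC⟩ := exists_superset_of_le hnk hB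
  by_cases h : A = C
  · exact Or.inl (h ▸ hBC)
  · exact Or.inr ((F.atoms_disjoint n hA hC h).mono_right hBC)

/-- Two atoms of a filtration are either nested or disjoint. -/
lemma nested_or_disjoint {A B : Set Ω} (hA : A ∈ F.Atoms) (hB : B ∈ F.Atoms) :
    A ⊆ B ∨ B ⊆ A ∨ Disjoint A B := by
  obtain ⟨n, hn⟩ := F.mem_Atoms.1 hA
  obtain ⟨k, hk⟩ := F.mem_Atoms.1 hB
  rcases le_total n k with h | h
  · exact Or.inr (subset_or_disjoint_of_le h hn hk)
  · rcases subset_or_disjoint_of_le h hk hn with h | h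
    · exact Or.inl h
    · exact Or.inr (Or.inr h.symm)

lemma IsAtomOrRing.nonempty {R : Set Ω} (hR : F.IsAtomOrRing R) : R.Nonempty := by
  rcases hR with h | ⟨A, _, B, _, _, _, h⟩
  · exact nonempty_of_mem_Atoms h
  · exact h

lemma measurableSet_of_mem_Atoms {A : Set Ω} (hA : A ∈ F.Atoms) : MeasurableSet A := by
  obtain ⟨n, hn⟩ := F.mem_Atoms.1 hA
  exact F.atoms_measurable n A hn

lemma IsAtomOrRing.measurableSet {R : Set Ω} (hR : F.IsAtomOrRing R) : MeasurableSet R := by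
  rcases hR with h | ⟨A, hA, B, hB, _, rfl, _⟩
  · exact measurableSet_of_mem_Atoms h
  · exact (measurableSet_of_mem_Atoms hA).diff (measurableSet_of_mem_Atoms hB)

/-- A set disjoint from a ring `A \ B` which is not itself an atom lies inside the hole `B` or
outside `A`, provided it is an atom or a ring. -/
lemma IsAtomOrRing.subset_or_disjoint_of_disjoint_diff {A B Z : Set Ω} (hZ : F.IsAtomOrRing Z)
    (hA : A ∈ F.Atoms) (hB : B ∈ F.Atoms) (hne : (A \ B).Nonempty) (hAB : A \ B ∉ F.Atoms)
    (hdisj : Disjoint (A \ B) Z) : Z ⊆ B ∨ Disjoint A Z := by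
  have key : ∀ {T : Set Ω}, T ⊆ A → Disjoint (A \ B) T → T ⊆ B := by
    intro T hT hd x hx
    by_contra hxB
    exact Set.disjoint_left.1 hd ⟨hT hx, hxB⟩ hx
  obtain ⟨x, hxA, hxB⟩ := hne
  rcases hZ with hZ | ⟨A', hA', B', hB', -, rfl, -⟩
  · rcases nested_or_disjoint hA hZ with h | h | h
    · exact absurd (h hxA) (Set.disjoint_left.1 hdisj ⟨hxA, hxB⟩)
    · exact Or.inl (key h hdisj)
    · exact Or.inr h
  · rcases nested_or_disjoint hA hA' with h | h | h
    · have hsub : A \ B ⊆ B' := fun y hy => by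
        by_contra hyB
        exact Set.disjoint_left.1 hdisj hy ⟨h hy.1, hyB⟩
      rcases nested_or_disjoint hA hB' with h1 | h1 | h1
      · exact Or.inr (Set.disjoint_left.2 fun y hy hy' => hy'.2 (h1 hy))
      · rcases nested_or_disjoint hB hB' with h2 | h2 | h2
        · refine Or.inr (Set.disjoint_left.2 fun y hy hy' => hy'.2 ?_)
          by_cases hyB : y ∈ B
          · exact h2 hyB
          · exact hsub ⟨hy, hyB⟩
        · exact absurd (h2 (hsub ⟨hxA, hxB⟩)) hxB
        · have : A \ B = B' := hsub.antisymm fun y hy => ⟨h1 hy, Set.disjoint_right.1 h2 hy⟩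
          exact absurd (this ▸ hB') hAB
      · exact absurd (hsub ⟨hxA, hxB⟩) (Set.disjoint_left.1 h1 hxA)
    · exact Or.inl (key (Set.sdiff_subset.trans h) hdisj)
    · exact Or.inr (h.mono_right Set.sdiff_subset)

/-- If `U` is an atom of level `n`, or a ring whose hole is an atom of level `n`, then every atom
of level `n` that meets `U` is contained in `U`. -/
lemma subset_of_inter_nonempty {A B C : Set Ω} {n : ℕ} (hA : A ∈ F.Atoms) (hBA : B ⊆ A)
    (h : (B = ∅ ∧ A ∈ F.atoms n) ∨ B ∈ F.atoms n) (hC : C ∈ F.atoms n)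
    (hne : (C ∩ (A \ B)).Nonempty) : C ⊆ A \ B := by
  obtain ⟨x, hxC, hxA, hxB⟩ := hne
  rcases h with ⟨rfl, hAn⟩ | hBn
  · rcases subset_or_disjoint_of_le le_rfl hAn hC with h | h
    · simpa using h
    · exact absurd hxC (Set.disjoint_left.1 h hxA)
  · have hCB : Disjoint C B := by
      refine F.atoms_disjoint n hC hBn ?_
      rintro rfl
      exact hxB hxC
    obtain ⟨k, hk⟩ := F.mem_Atoms.1 hA
    rcases le_total k n with hkn | hnk
    · rcases subset_or_disjoint_of_le hkn hk hC with h | h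
      · exact fun y hy => ⟨h hy, Set.disjoint_left.1 hCB hy⟩
      · exact absurd hxC (Set.disjoint_left.1 h hxA)
    · rcases subset_or_disjoint_of_le hnk hBn hk with h | h
      · exact absurd (h hxA) hxB
      · obtain ⟨y, hy⟩ := nonempty_of_mem_Atoms (F.mem_Atoms.2 ⟨n, hBn⟩)
        exact absurd (hBA hy) (Set.disjoint_left.1 h hy)

variable {𝒰 : Finset (Set Ω)} {m : Set Ω → ℕ}

lemma isAtomOrRing_of_mem_PiU {X : Set Ω} (hX : X ∈ PiU F 𝒰 m) : F.IsAtomOrRing X := by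
  rcases hX with ⟨h, -⟩ | ⟨A, hA, B, hB, -, -, rfl, hne⟩
  · exact Or.inl h
  · rcases nested_or_disjoint hA hB with h | h | h
    · exact absurd (Set.sdiff_eq_empty.2 h) hne.ne_empty
    · exact Or.inr ⟨A, hA, B, hB, h, rfl, hne⟩
    · exact Or.inl (h.sdiff_eq_left.symm ▸ hA)

lemma exists_mem_atomsU (h𝒰 : ⋃₀ (↑𝒰 : Set (Set Ω)) = Set.univ) (ω : Ω) :
    ∃ Y ∈ atomsU F 𝒰 m, ω ∈ Y := by
  obtain ⟨U, hU, hωU⟩ : ω ∈ ⋃₀ (↑𝒰 : Set (Set Ω)) := h𝒰 ▸ Set.mem_univ ω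
  obtain ⟨C, hC, hωC⟩ : ω ∈ ⋃₀ F.atoms (m U) := F.atoms_cover (m U) ▸ Set.mem_univ ω
  exact ⟨C ∩ U, ⟨U, hU, C, hC, rfl, ω, hωC, hωU⟩, hωC, hωU⟩

lemma finite_PiU (hY : ∀ Y ∈ atomsU F 𝒰 m, ∃ U ∈ 𝒰, Y ∈ F.atoms (m U) ∧ Y ⊆ U) :
    (PiU F 𝒰 m).Finite := by
  let G : Set (Set Ω) := ⋃ n ∈ Finset.range (𝒰.sup m + 1), F.atoms n
  have hGfin : G.Finite := (Finset.finite_toSet _).biUnion fun n _ => F.atoms_finite n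
  have hG : ∀ A ∈ F.Atoms, (∃ Y ∈ atomsU F 𝒰 m, Y ⊆ A) → A ∈ G := by
    rintro A hA ⟨Y, hYm, hYA⟩
    obtain ⟨U, hU, hYU, -⟩ := hY Y hYm
    obtain ⟨k, hk⟩ := F.mem_Atoms.1 hA
    have hmU : m U ≤ 𝒰.sup m := Finset.le_sup hU
    have mem : ∀ {n : ℕ} {T : Set Ω}, n ≤ m U → T ∈ F.atoms n → T ∈ G := fun hn hT =>
      Set.mem_biUnion (Finset.mem_coe.2 (Finset.mem_range.2 (by omega))) hT
    rcases le_total k (m U) with h | h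
    · exact mem h hk
    · rcases subset_or_disjoint_of_le h hYU hk with h | h
      · exact mem le_rfl (h.antisymm hYA ▸ hYU)
      · obtain ⟨y, hy⟩ := nonempty_of_mem_Atoms (F.mem_Atoms.2 ⟨_, hYU⟩)
        exact absurd (hYA hy) (Set.disjoint_left.1 h hy)
  refine (hGfin.union (hGfin.image2 (· \ ·) hGfin)).subset ?_
  rintro X (⟨hX, Y, hYm, hYX⟩ | ⟨A, hA, B, hB, ⟨Y, hYm, hYA⟩, hYB, rfl, -⟩)
  · exact Or.inl (hG X hX ⟨Y, hYm, hYX.subset⟩)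
  · exact Or.inr ⟨A, hG A hA ⟨Y, hYm, hYA.subset⟩, B, hG B hB hYB, rfl⟩

/-- `T` is `X`, or an atom obtained from a ring `X` by filling in a hole that is contained in a
single element of `𝒰`. -/
def IsFilling (F : FiltrationAtoms Ω μ) (𝒰 : Finset (Set Ω)) (X T : Set Ω) : Prop :=
  T = X ∨ T ∈ F.Atoms ∧ X ∉ F.Atoms ∧ ∃ B ∈ F.Atoms, X = T \ B ∧ X.Nonempty ∧ ∃ U ∈ 𝒰, B ⊆ U

lemma IsFilling.subset {X T : Set Ω} (h : F.IsFilling 𝒰 X T) : X ⊆ T := by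
  rcases h with rfl | ⟨-, -, B, -, rfl, -⟩
  · exact Subset.rfl
  · exact Set.sdiff_subset

lemma IsFilling.isAtomOrRing {X T : Set Ω} (h : F.IsFilling 𝒰 X T) (hX : F.IsAtomOrRing X) :
    F.IsAtomOrRing T := by
  rcases h with rfl | ⟨hT, -⟩
  · exact hX
  · exact Or.inl hT

lemma IsFilling.disjoint {X T Z : Set Ω} (h : F.IsFilling 𝒰 X T) (hZ : F.IsAtomOrRing Z)
    (hZU : ∀ U ∈ 𝒰, ¬ Z ⊆ U) (hXZ : Disjoint X Z) : Disjoint T Z := by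
  rcases h with rfl | ⟨hT, hX, B, hB, rfl, hne, U, hU, hBU⟩
  · exact hXZ
  · exact (hZ.subset_or_disjoint_of_disjoint_diff hT hB hne hX hXZ).resolve_left
      fun h => hZU U hU (h.trans hBU)

lemma IsAtomOrRing.exists_isFilling (h𝒰 : ⋃₀ (↑𝒰 : Set (Set Ω)) = Set.univ)
    (hY : ∀ Y ∈ atomsU F 𝒰 m, ∃ U ∈ 𝒰, Y ∈ F.atoms (m U) ∧ Y ⊆ U) {X : Set Ω}
    (hX : F.IsAtomOrRing X) (hXU : ∀ U ∈ 𝒰, ¬ X ⊆ U) :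
    ∃ T ∈ PiU F 𝒰 m, F.IsFilling 𝒰 X T := by
  have hdich : ∀ A ∈ F.Atoms, (∃ Y ∈ atomsU F 𝒰 m, Y ⊂ A) ∨
      ∃ Y ∈ atomsU F 𝒰 m, A ⊆ Y ∧ ∃ U ∈ 𝒰, Y ⊆ U := by
    intro A hA
    obtain ⟨x, hx⟩ := nonempty_of_mem_Atoms hA
    obtain ⟨Y, hYm, hxY⟩ := exists_mem_atomsU (F := F) (m := m) h𝒰 x
    obtain ⟨U, hU, hYl, hYU⟩ := hY Y hYm
    by_cases h : A ⊆ Y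
    · exact Or.inr ⟨Y, hYm, h, U, hU, hYU⟩
    · rcases nested_or_disjoint hA (F.mem_Atoms.2 ⟨_, hYl⟩) with h' | h' | h'
      · exact absurd h' h
      · exact Or.inl ⟨Y, hYm, h', h⟩
      · exact absurd hxY (Set.disjoint_left.1 h' hx)
  have atom_mem : ∀ A ∈ F.Atoms, X ⊆ A → ∃ Y ∈ atomsU F 𝒰 m, Y ⊂ A := fun A hA hXA =>
    (hdich A hA).resolve_right fun ⟨_, _, hAY, U, hU, hYU⟩ =>
      hXU U hU (hXA.trans (hAY.trans hYU))
  by_cases hXat : X ∈ F.Atoms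
  · exact ⟨X, Or.inl ⟨hXat, atom_mem X hXat Subset.rfl⟩, Or.inl rfl⟩
  obtain ⟨A, hA, B, hB, -, hXeq, hne⟩ := hX.resolve_left hXat
  have hYA := atom_mem A hA (hXeq ▸ Set.sdiff_subset)
  by_cases hYB : ∃ Y ∈ atomsU F 𝒰 m, Y ⊆ B
  · exact ⟨X, Or.inr ⟨A, hA, B, hB, hYA, hYB, hXeq, hne⟩, Or.inl rfl⟩
  · obtain ⟨Y, -, hBY, U, hU, hYU⟩ := (hdich B hB).resolve_left
      fun ⟨Y, hYm, h⟩ => hYB ⟨Y, hYm, h.subset⟩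
    exact ⟨A, Or.inl ⟨hA, hYA⟩, Or.inr ⟨hA, hXat, B, hB, hXeq, hne, U, hU, hBY.trans hYU⟩⟩

end FiltrationAtoms

section Ep

variable {Ω : Type} [MeasurableSpace Ω] {μ : Measure Ω} {S : Submodule ℝ (Ω → ℝ)} {p : ℝ}
  {f : Ω → ℝ}

lemma Ep_mono {X T : Set Ω} (h : X ⊆ T) : Ep S p μ f X ≤ Ep S p μ f T :=
  iInf₂_mono fun _ _ => eLpNorm_mono_measure _ (Measure.restrict_mono h le_rfl)

lemma Ep_eq_zero {X : Set Ω} (hX : MeasurableSet X) {g : Ω → ℝ} (hg : g ∈ S)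
    (hfg : Set.EqOn f g X) : Ep S p μ f X = 0 := by
  refine le_antisymm ((iInf₂_le g hg).trans ?_) zero_le
  have : f - g =ᵐ[μ.restrict X] 0 :=
    ae_restrict_of_forall_mem hX fun x hx => by simp [hfg hx]
  rw [eLpNorm_congr_ae this, eLpNorm_zero]

end Ep

lemma eqOn_of_eq_sum_indicator {Ω : Type} {f : Ω → ℝ} {𝒰 : Finset (Set Ω)}
    (h𝒰 : (↑𝒰 : Set (Set Ω)).Pairwise Disjoint) {g : Set Ω → Ω → ℝ}
    (hf : f = ∑ U ∈ 𝒰, U.indicator (g U)) {U : Set Ω} (hU : U ∈ 𝒰) : Set.EqOn f (g U) U := by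
  intro x hx
  rw [hf, Finset.sum_apply, Finset.sum_eq_single_of_mem U hU]
  · exact Set.indicator_of_mem hx _
  · intro V hV hVU
    exact Set.indicator_of_notMem (Set.disjoint_right.1 (h𝒰 hV hU hVU) hx) _

open FiltrationAtoms in
/-- Every family of disjoint atoms or rings is dominated by one made of elements of `PiU`. -/
lemma exists_PiU_family_sum_le {Ω : Type} [MeasurableSpace Ω] {μ : Measure Ω}
    {F : FiltrationAtoms Ω μ} {𝒰 : Finset (Set Ω)} {m : Set Ω → ℕ} {e : Set Ω → ℝ≥0∞}
    (h𝒰 : ⋃₀ (↑𝒰 : Set (Set Ω)) = Set.univ)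
    (hY : ∀ Y ∈ atomsU F 𝒰 m, ∃ U ∈ 𝒰, Y ∈ F.atoms (m U) ∧ Y ⊆ U)
    (he : ∀ X T, X ⊆ T → e X ≤ e T)
    (he0 : ∀ X, F.IsAtomOrRing X → ∀ U ∈ 𝒰, X ⊆ U → e X = 0)
    {P : Finset (Set Ω)} (hP : ∀ X ∈ P, F.IsAtomOrRing X)
    (hPdisj : (↑P : Set (Set Ω)).Pairwise Disjoint) :
    ∃ R : Finset (Set Ω), (∀ X ∈ R, X ∈ PiU F 𝒰 m) ∧
      (↑R : Set (Set Ω)).Pairwise Disjoint ∧ ∑ X ∈ P, e X ≤ ∑ X ∈ R, e X := by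
  let Q := P.filter fun X => ∀ U ∈ 𝒰, ¬ X ⊆ U
  have hQ : ∀ X ∈ Q, X ∈ P ∧ ∀ U ∈ 𝒰, ¬ X ⊆ U := fun X hX => Finset.mem_filter.1 hX
  have hfill : ∀ X, ∃ T, X ∈ Q → T ∈ PiU F 𝒰 m ∧ F.IsFilling 𝒰 X T := by
    intro X
    by_cases hX : X ∈ Q
    · obtain ⟨T, hT⟩ := (hP X (hQ X hX).1).exists_isFilling h𝒰 hY (hQ X hX).2
      exact ⟨T, fun _ => hT⟩
    · exact ⟨∅, fun h => absurd h hX⟩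
  choose φ hφ using hfill
  have hdisj : ∀ X ∈ Q, ∀ Z ∈ Q, X ≠ Z → Disjoint (φ X) (φ Z) := by
    intro X hX Z hZ hXZ
    have h1 : Disjoint (φ X) Z := (hφ X hX).2.disjoint (hP Z (hQ Z hZ).1) (hQ Z hZ).2
      (hPdisj (hQ X hX).1 (hQ Z hZ).1 hXZ)
    exact ((hφ Z hZ).2.disjoint ((hφ X hX).2.isAtomOrRing (hP X (hQ X hX).1))
      (fun U hU h => (hQ X hX).2 U hU ((hφ X hX).2.subset.trans h)) h1.symm).symm
  have hinj : Set.InjOn φ Q := by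
    intro X hX Z hZ h
    by_contra hXZ
    have hd := hdisj X hX Z hZ hXZ
    rw [← h, disjoint_self] at hd
    obtain ⟨x, hx⟩ := (hP X (hQ X hX).1).nonempty
    exact (Set.eq_empty_iff_forall_notMem.1 hd) x ((hφ X hX).2.subset hx)
  refine ⟨Q.image φ, ?_, ?_, ?_⟩
  · intro X hX
    obtain ⟨Z, hZ, rfl⟩ := Finset.mem_image.1 hX
    exact (hφ Z hZ).1
  · rw [Finset.coe_image]
    rintro _ ⟨X, hX, rfl⟩ _ ⟨Z, hZ, rfl⟩ hXZ
    exact hdisj X hX Z hZ fun h => hXZ (h ▸ rfl)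
  · rw [Finset.sum_image hinj]
    calc ∑ X ∈ P, e X = ∑ X ∈ Q, e X := by
          refine (Finset.sum_subset (Finset.filter_subset _ _) fun X hX hXQ => ?_).symm
          have : ∃ U ∈ 𝒰, X ⊆ U := by
            by_contra! h
            exact hXQ (Finset.mem_filter.2 ⟨hX, h⟩)
          obtain ⟨U, hU, hXU⟩ := this
          exact he0 X (hP X hX) U hU hXU
      _ ≤ ∑ X ∈ Q, e (φ X) := Finset.sum_le_sum fun X hX => he _ _ (hφ X hX).2.subset

/-- If `𝒰` is a finite partition of `Ω` into disjoint rings or atoms and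
`f = ∑_{U ∈ 𝒰} f_U` with `f_U ∈ S_U`, then
`|f|_{V_{σ,p}(S)} = max_{𝓡 ∈ ℛ(𝒰)} (∑_{R ∈ 𝓡} E_p(f,R)^σ)^{1/σ}`, where `ℛ(𝒰)` is the
set of finite families of pairwise disjoint elements of `Π_𝒰`; i.e. `|f|_{V_{σ,p}(S)}` is
the greatest element of the set of such values. -/
theorem statement8
    {Ω : Type} [MeasurableSpace Ω] {μ : Measure Ω} [IsProbabilityMeasure μ]
    (F : FiltrationAtoms Ω μ) (ν : ℕ) (hν : 2 ≤ ν) (hFν : F.IsNuAry ν)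
    (S : Submodule ℝ (Ω → ℝ)) (hSfin : Module.Finite ℝ S)
    (hSmeas : ∀ g ∈ S, Measurable g) (hSbdd : ∀ g ∈ S, eLpNormEssSup g μ ≠ ∞)
    (σ p : ℝ) (hσ : 0 < σ) (hσp : σ < p)
    (𝒰 : Finset (Set Ω))
    (h𝒰disj : (↑𝒰 : Set (Set Ω)).Pairwise Disjoint)
    (h𝒰cover : ⋃₀ (↑𝒰 : Set (Set Ω)) = Set.univ)
    (h𝒰ring : ∀ U ∈ 𝒰, F.IsAtomOrRing U)
    (AU BU : Set Ω → Set Ω) (m : Set Ω → ℕ)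
    (hAB : ∀ U ∈ 𝒰, AU U ∈ F.Atoms ∧ BU U ⊆ AU U ∧ U = AU U \ BU U ∧
      ((BU U = ∅ ∧ AU U ∈ F.atoms (m U) ∧ ∀ k, AU U ∈ F.atoms k → m U ≤ k) ∨
       (BU U ≠ ∅ ∧ BU U ∈ F.Atoms ∧ BU U ∈ F.atoms (m U) ∧
         ∀ k, BU U ∈ F.atoms k → m U ≤ k)))
    (gU : Set Ω → Ω → ℝ) (hgU : ∀ U ∈ 𝒰, gU U ∈ S)
    (f : Ω → ℝ) (hf : f = ∑ U ∈ 𝒰, U.indicator (gU U)) :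
    IsGreatest
      {v : ℝ≥0∞ | ∃ R : Finset (Set Ω), (∀ X ∈ R, X ∈ PiU F 𝒰 m) ∧
        (↑R : Set (Set Ω)).Pairwise Disjoint ∧
        v = (∑ X ∈ R, Ep S p μ f X ^ σ) ^ (1 / σ)}
      (varSeminorm F S σ p f) := by
  have hY : ∀ Y ∈ atomsU F 𝒰 m, ∃ U ∈ 𝒰, Y ∈ F.atoms (m U) ∧ Y ⊆ U := by
    rintro Y ⟨U, hU, C, hC, rfl, hne⟩
    obtain ⟨hA, hBA, hUeq, h⟩ := hAB U hU
    have hCU : C ⊆ U := by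
      have := FiltrationAtoms.subset_of_inter_nonempty hA hBA
        (h.imp (fun h => ⟨h.1, h.2.1⟩) (fun h => h.2.2.1)) hC (hUeq ▸ hne)
      rwa [← hUeq] at this
    exact ⟨U, hU, (Set.inter_eq_left.2 hCU).symm ▸ hC, Set.inter_subset_right⟩
  set V : Set ℝ≥0∞ := {v | ∃ R : Finset (Set Ω), (∀ X ∈ R, X ∈ PiU F 𝒰 m) ∧
    (↑R : Set (Set Ω)).Pairwise Disjoint ∧ v = (∑ X ∈ R, Ep S p μ f X ^ σ) ^ (1 / σ)}
  have hfin : V.Finite := by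
    have hPi := FiltrationAtoms.finite_PiU hY
    refine (hPi.toFinset.powerset.finite_toSet.image
      fun R => (∑ X ∈ R, Ep S p μ f X ^ σ) ^ (1 / σ)).subset ?_
    rintro v ⟨R, hR, -, rfl⟩
    exact ⟨R, by simpa [Set.subset_def] using hR, rfl⟩
  have hupper : ∀ v ∈ V, v ≤ varSeminorm F S σ p f := by
    rintro v ⟨R, hR, hRd, rfl⟩
    exact le_iSup_of_le R (le_iSup₂_of_le
      (fun X hX => FiltrationAtoms.isAtomOrRing_of_mem_PiU (hR X hX)) hRd le_rfl)
  obtain ⟨M, hM, hmax⟩ := Set.exists_max_image V id hfin ⟨_, ∅, by simp, by simp, rfl⟩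
  have hle : varSeminorm F S σ p f ≤ M := by
    refine iSup_le fun P => iSup₂_le fun hP hPd => ?_
    obtain ⟨R, hR, hRd, hsum⟩ := exists_PiU_family_sum_le (e := fun X => Ep S p μ f X ^ σ)
      h𝒰cover hY (fun X T h => ENNReal.rpow_le_rpow (Ep_mono h) hσ.le)
      (fun X hX U hU hXU => by
        rw [Ep_eq_zero hX.measurableSet (hgU U hU)
          ((eqOn_of_eq_sum_indicator h𝒰disj hf hU).mono hXU), ENNReal.zero_rpow_of_pos hσ])
      hP hPd
    exact (ENNReal.rpow_le_rpow hsum (by positivity)).trans (hmax _ ⟨R, hR, hRd, rfl⟩)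
  exact ⟨hle.antisymm (hupper M hM) ▸ hM, hupper⟩
end

section
/- Let 0 < σ < p < ∞, β = 1/σ − 1/p, and for Λ ⊂ ℕ define f_Λ = Σ_{j∈Λ} 2^{−jβ} r_j on [0,1]. Then: (1) there is a constant C (independent of Λ) with |f_Λ|_{V_{σ,p}} ≤ C, so f_Λ ∈ V_{σ,p}; (2) there is a constant c > 0 (independent of Λ, Γ) such that for every Γ ⊂ ℕ with Γ ≠ Λ, |f_Γ − f_Λ|_{V_{σ,p}} ≥ c. -/
open MeasureTheory ENNReal Set Filter
open scoped ENNReal NNReal Classical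

noncomputable section

/-- A dyadic atom: a dyadic subinterval `[k/2^n, (k+1)/2^n)` of `[0,1)`. -/
def dyAtom (A : Set ℝ) : Prop :=
  ∃ n k : ℕ, k < 2 ^ n ∧ A = Set.Ico ((k : ℝ) / 2 ^ n) (((k : ℝ) + 1) / 2 ^ n)

/-- A dyadic atom or a nonempty ring `A \ B` of two nested dyadic atoms. -/
def dyAtomOrRing (R : Set ℝ) : Prop :=
  dyAtom R ∨ ∃ A B : Set ℝ, dyAtom A ∧ dyAtom B ∧ B ⊆ A ∧ R = A \ B ∧ R.Nonempty

/-- `E_p(f,R)` for `S = span{1}`: the best `L^p(R)`-approximation of `f` by constants. -/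
def EpD (p : ℝ) (f : ℝ → ℝ) (R : Set ℝ) : ℝ≥0∞ :=
  ⨅ c : ℝ, eLpNorm (fun t => f t - c) (ENNReal.ofReal p) (volume.restrict R)

/-- The dyadic ring-variation seminorm `|f|_{V_{σ,p}}`. -/
def varD (σ p : ℝ) (f : ℝ → ℝ) : ℝ≥0∞ :=
  ⨆ (P : Finset (Set ℝ)) (_ : ∀ R ∈ P, dyAtomOrRing R)
    (_ : (↑P : Set (Set ℝ)).Pairwise Disjoint),
    (∑ R ∈ P, EpD p f R ^ σ) ^ (1 / σ)

/-- The `n`-th Rademacher function (equal a.e. to `sign (sin (2^n π t))`):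
`𝒟_n`-measurable with values `±1`. -/
def rademacher (n : ℕ) (t : ℝ) : ℝ :=
  if Even ⌊(2 : ℝ) ^ n * t⌋ then 1 else -1

/-- The function `f_Λ = ∑_{j ∈ Λ} 2^{-jβ} r_j`. -/
def fLam (β : ℝ) (Λ : Set ℕ) (t : ℝ) : ℝ :=
  ∑' j : ℕ, Λ.indicator (fun j => (2 : ℝ) ^ (-(j : ℝ) * β) * rademacher j t) j

end

lemma rademacher_eq_of_mem_Ico {n k j : ℕ} (hj : j ≤ n) {t : ℝ}
    (ht : t ∈ Set.Ico ((k : ℝ) / 2 ^ n) (((k : ℝ) + 1) / 2 ^ n)) :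
    rademacher j t = rademacher j ((k : ℝ) / 2 ^ n) := by
  have key : ∀ s ∈ Set.Ico ((k : ℝ) / 2 ^ n) (((k : ℝ) + 1) / 2 ^ n),
      ⌊(2 : ℝ) ^ j * s⌋ = (k : ℤ) / ((2 ^ (n - j) : ℕ) : ℤ) := by
    intro s hs
    have h2 : (2 : ℝ) ^ j * s = (2 ^ n * s) / ((2 ^ (n - j) : ℕ) : ℝ) := by
      rw [← Nat.sub_add_cancel hj, pow_add]
      simp only [Nat.add_sub_cancel]
      push_cast
      field_simp
    have h3 : ⌊(2 : ℝ) ^ n * s⌋ = (k : ℤ) := by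
      rw [Int.floor_eq_iff]
      rw [Set.mem_Ico, div_le_iff₀ (by positivity), lt_div_iff₀ (by positivity)] at hs
      push_cast
      constructor <;> linarith [hs.1, hs.2]
    rw [h2, Int.floor_div_natCast, h3]
  have hk : (k : ℝ) / 2 ^ n ∈ Set.Ico ((k : ℝ) / 2 ^ n) (((k : ℝ) + 1) / 2 ^ n) := by
    refine ⟨le_rfl, ?_⟩
    gcongr
    linarith
  simp only [rademacher, key t ht, key _ hk]

lemma rademacher_succ_add_half (n : ℕ) (t : ℝ) :
    rademacher (n + 1) (t + 1 / 2 ^ (n + 1)) = -rademacher (n + 1) t := by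
  have h : (2 : ℝ) ^ (n + 1) * (t + 1 / 2 ^ (n + 1)) = 2 ^ (n + 1) * t + 1 := by
    field_simp
  simp only [rademacher, h, Int.floor_add_one, Int.even_add_one]
  split_ifs <;> simp_all

lemma rademacher_add_of_lt {m j : ℕ} (hj : m < j) (t : ℝ) :
    rademacher j (t + 1 / 2 ^ m) = rademacher j t := by
  have h : (2 : ℝ) ^ j * (t + 1 / 2 ^ m) = 2 ^ j * t + ((2 ^ (j - m) : ℤ) : ℝ) := by
    rw [← Nat.sub_add_cancel hj.le, pow_add]
    simp only [Nat.add_sub_cancel]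
    push_cast
    field_simp
  have he : Even ((2 : ℤ) ^ (j - m)) := (even_two).pow_of_ne_zero (by omega)
  simp only [rademacher, h, Int.floor_add_intCast, Int.even_add, he, iff_true]

lemma abs_rademacher (j : ℕ) (t : ℝ) : |rademacher j t| = 1 := by
  unfold rademacher
  split_ifs <;> simp

lemma measurable_rademacher (j : ℕ) : Measurable (rademacher j) := by
  unfold rademacher
  refine Measurable.ite ?_ measurable_const measurable_const
  have h : Measurable fun t : ℝ => ⌊(2 : ℝ) ^ j * t⌋ :=
    Int.measurable_floor.comp (measurable_const.mul measurable_id)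
  exact h (MeasurableSet.of_discrete (s := {z : ℤ | Even z}))

section Series

variable {q : ℝ} {b : ℕ → ℝ}

lemma summable_rademacher (hq0 : 0 ≤ q) (hq1 : q < 1) (hb : ∀ j, |b j| ≤ q ^ j) (t : ℝ) :
    Summable fun j => b j * rademacher j t := by
  refine Summable.of_norm_bounded (summable_geometric_of_lt_one hq0 hq1) fun j => ?_
  rw [Real.norm_eq_abs, abs_mul, abs_rademacher, mul_one]
  exact hb j

lemma abs_tsum_rademacher_le (hq0 : 0 ≤ q) (hq1 : q < 1) (hb : ∀ j, |b j| ≤ q ^ j) (t : ℝ) :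
    |∑' j, b j * rademacher j t| ≤ (1 - q)⁻¹ := by
  rw [← Real.norm_eq_abs]
  refine tsum_of_norm_bounded (hasSum_geometric_of_lt_one hq0 hq1) fun j => ?_
  rw [Real.norm_eq_abs, abs_mul, abs_rademacher, mul_one]
  exact hb j

lemma measurable_tsum_rademacher (b : ℕ → ℝ) :
    Measurable fun t => ∑' j, b j * rademacher j t :=
  Measurable.tsum fun j => (measurable_rademacher j).const_mul (b j)

lemma abs_tsum_rademacher_sub_le (hq0 : 0 ≤ q) (hq1 : q < 1) (hb : ∀ j, |b j| ≤ q ^ j)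
    {n k : ℕ} {t : ℝ} (ht : t ∈ Set.Ico ((k : ℝ) / 2 ^ n) (((k : ℝ) + 1) / 2 ^ n)) :
    |∑' j, b j * rademacher j t - ∑' j, b j * rademacher j ((k : ℝ) / 2 ^ n)| ≤
      2 * (1 - q)⁻¹ * q ^ n := by
  have hs := (summable_rademacher hq0 hq1 hb t).sub
    (summable_rademacher hq0 hq1 hb ((k : ℝ) / 2 ^ n))
  rw [← (summable_rademacher hq0 hq1 hb t).tsum_sub
    (summable_rademacher hq0 hq1 hb ((k : ℝ) / 2 ^ n)), ← hs.sum_add_tsum_nat_add n,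
    Finset.sum_eq_zero, zero_add]
  · have hg : HasSum (fun j => 2 * q ^ n * q ^ j) (2 * q ^ n * (1 - q)⁻¹) :=
      (hasSum_geometric_of_lt_one hq0 hq1).mul_left _
    rw [← Real.norm_eq_abs, mul_right_comm]
    refine tsum_of_norm_bounded hg fun j => ?_
    rw [Real.norm_eq_abs, ← mul_sub, abs_mul]
    have h1 : |rademacher (j + n) t - rademacher (j + n) ((k : ℝ) / 2 ^ n)| ≤ 2 := by
      refine (abs_sub _ _).trans ?_
      rw [abs_rademacher, abs_rademacher]
      norm_num
    calc _ ≤ q ^ (j + n) * 2 := mul_le_mul (hb _) h1 (abs_nonneg _) (by positivity)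
      _ = _ := by ring
  · intro j hj
    rw [rademacher_eq_of_mem_Ico (Finset.mem_range.1 hj).le ht, sub_self]

lemma tsum_rademacher_sub_shift (hq0 : 0 ≤ q) (hq1 : q < 1) (hb : ∀ j, |b j| ≤ q ^ j)
    {n k : ℕ} {t : ℝ}
    (ht : t ∈ Set.Ico ((k : ℝ) / 2 ^ n) ((k : ℝ) / 2 ^ n + 1 / 2 ^ (n + 1))) :
    |∑' j, b j * rademacher j t - ∑' j, b j * rademacher j (t + 1 / 2 ^ (n + 1))| =
      2 * |b (n + 1)| := by
  have hpow : ((k : ℝ) + 1) / 2 ^ n = (k : ℝ) / 2 ^ n + 1 / 2 ^ (n + 1) + 1 / 2 ^ (n + 1) := by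
    rw [pow_succ]
    field_simp
    ring
  have hpos : (0 : ℝ) < 1 / 2 ^ (n + 1) := by positivity
  rw [← (summable_rademacher hq0 hq1 hb t).tsum_sub (summable_rademacher hq0 hq1 hb _),
    tsum_eq_single (n + 1)]
  · rw [rademacher_succ_add_half, ← mul_sub, sub_neg_eq_add, ← two_mul, abs_mul, abs_mul,
      abs_rademacher]
    simp
    ring
  · intro j hj
    rcases lt_or_gt_of_ne hj with h | h
    · rw [rademacher_eq_of_mem_Ico (n := n) (k := k) (by omega),
        rademacher_eq_of_mem_Ico (n := n) (k := k) (t := t + _) (by omega), sub_self]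
      · rw [hpow]
        exact ⟨by linarith [ht.1], by linarith [ht.2]⟩
      · rw [hpow]
        exact ⟨by linarith [ht.1], by linarith [ht.2]⟩
    · rw [rademacher_add_of_lt h, sub_self]

end Series

lemma le_eLpNorm_of_shift {p : ℝ} (hp : 0 < p) {h : ℝ → ℝ} (hh : Measurable h) {a δ x : ℝ}
    (hδ : 0 ≤ δ) (hx : ∀ t ∈ Set.Ico a (a + δ), 2 * x ≤ |h t - h (t + δ)|) :
    ENNReal.ofReal x * ENNReal.ofReal δ ^ (1 / p) ≤
      eLpNorm h (ENNReal.ofReal p) (volume.restrict (Set.Ico a (a + δ + δ))) := by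
  rw [eLpNorm_eq_lintegral_rpow_enorm_toReal (by simpa using hp) ENNReal.ofReal_ne_top,
    ENNReal.toReal_ofReal hp.le,
    ← Set.Ico_union_Ico_eq_Ico (b := a + δ) (by linarith) (by linarith),
    lintegral_union measurableSet_Ico (Set.Ico_disjoint_Ico_same)]
  have hshift : ∫⁻ t in Set.Ico (a + δ) (a + δ + δ), ‖h t‖ₑ ^ p =
      ∫⁻ t in Set.Ico a (a + δ), ‖h (t + δ)‖ₑ ^ p := by
    rw [← (measurePreserving_add_right volume δ).setLIntegral_comp_preimage_emb
      (measurableEmbedding_addRight δ)]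
    simp
  rw [hshift, ← lintegral_add_left (by fun_prop)]
  have hle : ENNReal.ofReal x ^ p * ENNReal.ofReal δ ≤
      ∫⁻ t in Set.Ico a (a + δ), (‖h t‖ₑ ^ p + ‖h (t + δ)‖ₑ ^ p) := by
    calc ENNReal.ofReal x ^ p * ENNReal.ofReal δ
        = ∫⁻ _ in Set.Ico a (a + δ), ENNReal.ofReal x ^ p := by simp
      _ ≤ _ := by
        refine setLIntegral_mono (by fun_prop) fun t ht => ?_
        have h1 := hx t ht
        have h2 := abs_sub (h t) (h (t + δ))
        rcases le_total x |h t| with h3 | h3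
        · refine le_add_right ?_
          rw [Real.enorm_eq_ofReal_abs]
          gcongr
        · refine le_add_left ?_
          rw [Real.enorm_eq_ofReal_abs]
          gcongr
          linarith
  calc _ = (ENNReal.ofReal x ^ p * ENNReal.ofReal δ) ^ (1 / p) := by
        rw [ENNReal.mul_rpow_of_nonneg _ _ (by positivity), ← ENNReal.rpow_mul,
          mul_one_div_cancel hp.ne', ENNReal.rpow_one]
    _ ≤ _ := by gcongr

lemma dyAtom.measurableSet {A : Set ℝ} (hA : dyAtom A) : MeasurableSet A := by
  obtain ⟨n, k, -, rfl⟩ := hA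
  exact measurableSet_Ico

lemma dyAtomOrRing.measurableSet {R : Set ℝ} (hR : dyAtomOrRing R) : MeasurableSet R := by
  rcases hR with hR | ⟨A, B, hA, hB, -, rfl, -⟩
  · exact hR.measurableSet
  · exact hA.measurableSet.diff hB.measurableSet

lemma volume_Ico_dyadic (n k : ℕ) :
    volume (Set.Ico ((k : ℝ) / 2 ^ n) (((k : ℝ) + 1) / 2 ^ n)) = ENNReal.ofReal (1 / 2 ^ n) := by
  rw [Real.volume_Ico]
  congr 1
  ring

lemma Ico_dyadic_subset {n k : ℕ} (hk : k < 2 ^ n) :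
    Set.Ico ((k : ℝ) / 2 ^ n) (((k : ℝ) + 1) / 2 ^ n) ⊆ Set.Ico 0 1 := by
  refine Set.Ico_subset_Ico (by positivity) ?_
  rw [div_le_one (by positivity)]
  exact_mod_cast hk

/-- A ring has at least half the measure of the atom it is cut from. -/
lemma dyAtomOrRing.exists_subset {R : Set ℝ} (hR : dyAtomOrRing R) :
    ∃ n k : ℕ, k < 2 ^ n ∧ R ⊆ Set.Ico ((k : ℝ) / 2 ^ n) (((k : ℝ) + 1) / 2 ^ n) ∧
      ENNReal.ofReal (1 / 2 ^ n) ≤ 2 * volume R := by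
  rcases hR with ⟨n, k, hk, rfl⟩ | ⟨A, B, ⟨n, k, hk, rfl⟩, ⟨m, l, hl, rfl⟩, hBA, rfl, hne⟩
  · refine ⟨n, k, hk, subset_rfl, ?_⟩
    rw [volume_Ico_dyadic, two_mul]
    exact le_add_self
  · refine ⟨n, k, hk, Set.sdiff_subset, ?_⟩
    have hlt : (l : ℝ) / 2 ^ m < ((l : ℝ) + 1) / 2 ^ m := by
      gcongr
      linarith
    obtain ⟨h1, h2⟩ := (Set.Ico_subset_Ico_iff hlt).1 hBA
    have hnm : n < m := by
      by_contra! hmn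
      have hp : (1 : ℝ) / 2 ^ n ≤ 1 / 2 ^ m :=
        one_div_le_one_div_of_le (by positivity) (pow_le_pow_right₀ (by norm_num) hmn)
      have e1 : ((k : ℝ) + 1) / 2 ^ n = k / 2 ^ n + 1 / 2 ^ n := by ring
      have e2 : ((l : ℝ) + 1) / 2 ^ m = l / 2 ^ m + 1 / 2 ^ m := by ring
      refine hne.ne_empty (Set.sdiff_eq_empty.2 (Set.Ico_subset_Ico ?_ ?_)) <;> linarith
    rw [measure_sdiff hBA measurableSet_Ico.nullMeasurableSet (by simp), volume_Ico_dyadic,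
      volume_Ico_dyadic, ← ENNReal.ofReal_sub _ (by positivity),
      show (2 : ℝ≥0∞) = ENNReal.ofReal 2 by simp, ← ENNReal.ofReal_mul (by norm_num)]
    apply ENNReal.ofReal_le_ofReal
    have hp : (1 : ℝ) / 2 ^ m ≤ 1 / 2 ^ (n + 1) :=
      one_div_le_one_div_of_le (by positivity) (pow_le_pow_right₀ (by norm_num) hnm)
    have e : (1 : ℝ) / 2 ^ (n + 1) = 1 / 2 ^ n / 2 := by
      rw [pow_succ]
      field_simp
    linarith

section Variation

variable {σ p q : ℝ} {b : ℕ → ℝ}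

lemma ofReal_pow_eq (hq : q = (2 : ℝ) ^ (-(1 / σ - 1 / p))) (n : ℕ) :
    ENNReal.ofReal (q ^ n) = ENNReal.ofReal (1 / 2 ^ n) ^ (1 / σ - 1 / p) := by
  rw [ENNReal.ofReal_rpow_of_pos (by positivity), hq, ← Real.rpow_natCast, ← Real.rpow_mul two_pos.le,
    one_div ((2 : ℝ) ^ n), ← Real.rpow_natCast, ← Real.rpow_neg two_pos.le,
    ← Real.rpow_mul two_pos.le]
  congr 2
  ring

lemma EpD_rpow_le (hσ : 0 < σ) (hσp : σ < p) (hq : q = (2 : ℝ) ^ (-(1 / σ - 1 / p)))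
    (hq1 : q < 1) (hb : ∀ j, |b j| ≤ q ^ j) {R : Set ℝ} (hR : dyAtomOrRing R) :
    EpD p (fun t => ∑' j, b j * rademacher j t) R ^ σ ≤
      (ENNReal.ofReal (2 * (1 - q)⁻¹) * 2 ^ (1 / σ - 1 / p)) ^ σ * volume R := by
  have hp : 0 < p := hσ.trans hσp
  have hβ : 0 ≤ 1 / σ - 1 / p := sub_nonneg.2 (one_div_le_one_div_of_le hσ hσp.le)
  have hq0 : 0 ≤ q := hq ▸ by positivity
  obtain ⟨n, k, -, hsub, hvol⟩ := hR.exists_subset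
  have h1 : EpD p (fun t => ∑' j, b j * rademacher j t) R ≤
      volume R ^ (1 / p) * ENNReal.ofReal (2 * (1 - q)⁻¹ * q ^ n) := by
    refine (iInf_le _ (∑' j, b j * rademacher j ((k : ℝ) / 2 ^ n))).trans ?_
    refine (eLpNorm_le_of_ae_bound (C := 2 * (1 - q)⁻¹ * q ^ n) ?_).trans_eq ?_
    · filter_upwards [ae_restrict_mem hR.measurableSet] with t ht
      exact abs_tsum_rademacher_sub_le hq0 hq1 hb (hsub ht)
    · simp [ENNReal.toReal_ofReal hp.le]
  have h2 : EpD p (fun t => ∑' j, b j * rademacher j t) R ≤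
      ENNReal.ofReal (2 * (1 - q)⁻¹) * 2 ^ (1 / σ - 1 / p) * volume R ^ (1 / σ) := by
    calc _ ≤ _ := h1
      _ = volume R ^ (1 / p) * (ENNReal.ofReal (2 * (1 - q)⁻¹) *
            ENNReal.ofReal (1 / 2 ^ n) ^ (1 / σ - 1 / p)) := by
          rw [ENNReal.ofReal_mul (mul_nonneg two_pos.le (inv_nonneg.2 (by linarith))),
            ofReal_pow_eq hq]
      _ ≤ volume R ^ (1 / p) * (ENNReal.ofReal (2 * (1 - q)⁻¹) *
            (2 * volume R) ^ (1 / σ - 1 / p)) := by gcongr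
      _ = ENNReal.ofReal (2 * (1 - q)⁻¹) * 2 ^ (1 / σ - 1 / p) *
            (volume R ^ (1 / p) * volume R ^ (1 / σ - 1 / p)) := by
          rw [ENNReal.mul_rpow_of_nonneg _ _ hβ]
          ring
      _ = _ := by
          rw [← ENNReal.rpow_add_of_nonneg _ _ (by positivity) hβ, add_sub_cancel]
  calc _ ≤ (ENNReal.ofReal (2 * (1 - q)⁻¹) * 2 ^ (1 / σ - 1 / p) * volume R ^ (1 / σ)) ^ σ := by
        gcongr
    _ = _ := by
        rw [ENNReal.mul_rpow_of_nonneg _ _ hσ.le, ← ENNReal.rpow_mul (volume R),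
          one_div_mul_cancel hσ.ne', ENNReal.rpow_one]

lemma varD_le (hσ : 0 < σ) (hσp : σ < p) (hq : q = (2 : ℝ) ^ (-(1 / σ - 1 / p)))
    (hq1 : q < 1) (hb : ∀ j, |b j| ≤ q ^ j) :
    varD σ p (fun t => ∑' j, b j * rademacher j t) ≤
      ENNReal.ofReal (2 * (1 - q)⁻¹) * 2 ^ (1 / σ - 1 / p) := by
  refine iSup_le fun P => iSup_le fun hP => iSup_le fun hdisj => ?_
  have hvol : ∑ R ∈ P, volume R ≤ 1 := by
    rw [← measure_biUnion_finset hdisj fun R hR => (hP R hR).measurableSet]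
    refine (measure_mono (t := Set.Ico (0 : ℝ) 1) (Set.iUnion₂_subset fun R hR => ?_)).trans_eq
      (by simp)
    obtain ⟨n, k, hk, hsub, -⟩ := (hP R hR).exists_subset
    exact hsub.trans (Ico_dyadic_subset hk)
  rw [one_div, ENNReal.rpow_inv_le_iff hσ]
  calc _ ≤ ∑ R ∈ P, (ENNReal.ofReal (2 * (1 - q)⁻¹) * 2 ^ (1 / σ - 1 / p)) ^ σ * volume R :=
        Finset.sum_le_sum fun R hR => EpD_rpow_le hσ hσp hq hq1 hb (hP R hR)
    _ ≤ _ := by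
        rw [← Finset.mul_sum]
        simpa using mul_le_mul_right hvol _

lemma le_EpD_rpow (hσ : 0 < σ) (hσp : σ < p) (hq : q = (2 : ℝ) ^ (-(1 / σ - 1 / p)))
    (hq1 : q < 1) (hb : ∀ j, |b j| ≤ q ^ j) {n : ℕ} (hn : |b (n + 1)| = q ^ (n + 1)) (k : ℕ) :
    ENNReal.ofReal (1 / 2 ^ (n + 1)) ≤ EpD p (fun t => ∑' j, b j * rademacher j t)
      (Set.Ico ((k : ℝ) / 2 ^ n) (((k : ℝ) + 1) / 2 ^ n)) ^ σ := by
  have hp : 0 < p := hσ.trans hσp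
  have hβ : 0 ≤ 1 / σ - 1 / p := sub_nonneg.2 (one_div_le_one_div_of_le hσ hσp.le)
  have hq0 : 0 ≤ q := hq ▸ by positivity
  have hpow : ((k : ℝ) + 1) / 2 ^ n = (k : ℝ) / 2 ^ n + 1 / 2 ^ (n + 1) + 1 / 2 ^ (n + 1) := by
    rw [pow_succ]
    field_simp
    ring
  rw [← ENNReal.rpow_inv_le_iff hσ]
  refine le_iInf fun c => ?_
  rw [hpow]
  refine le_trans (le_of_eq ?_) (le_eLpNorm_of_shift (x := q ^ (n + 1)) hp
    ((measurable_tsum_rademacher b).sub_const c) (by positivity) fun t ht => ?_)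
  · rw [ofReal_pow_eq hq, ← ENNReal.rpow_add_of_nonneg _ _ hβ (by positivity), sub_add_cancel,
      one_div σ]
  · rw [sub_sub_sub_cancel_right, tsum_rademacher_sub_shift hq0 hq1 hb ht, hn]

lemma Ico_dyadic_disjoint (n : ℕ) {k l : ℕ} (hkl : k ≠ l) :
    Disjoint (Set.Ico ((k : ℝ) / 2 ^ n) (((k : ℝ) + 1) / 2 ^ n))
      (Set.Ico ((l : ℝ) / 2 ^ n) (((l : ℝ) + 1) / 2 ^ n)) := by
  wlog h : k < l generalizing k l
  · exact (this hkl.symm (by omega)).symm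
  rw [Set.disjoint_left]
  intro t ht ht'
  have : ((k : ℝ) + 1) / 2 ^ n ≤ l / 2 ^ n := by
    gcongr
    exact_mod_cast h
  linarith [ht.2, ht'.1]

lemma le_varD (hσ : 0 < σ) (hσp : σ < p) (hq : q = (2 : ℝ) ^ (-(1 / σ - 1 / p)))
    (hq1 : q < 1) (hb : ∀ j, |b j| ≤ q ^ j) {n : ℕ} (hn : |b (n + 1)| = q ^ (n + 1)) :
    ENNReal.ofReal (1 / 2) ^ (1 / σ) ≤ varD σ p (fun t => ∑' j, b j * rademacher j t) := by
  set I : ℕ → Set ℝ := fun k => Set.Ico ((k : ℝ) / 2 ^ n) (((k : ℝ) + 1) / 2 ^ n) with hI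
  have hne : ∀ k, (I k).Nonempty := fun k => by
    rw [hI, Set.nonempty_Ico]
    gcongr
    linarith
  have hinj : Function.Injective I := fun k l hkl => by
    by_contra h
    have := Ico_dyadic_disjoint n h
    rw [show Set.Ico ((k : ℝ) / 2 ^ n) (((k : ℝ) + 1) / 2 ^ n) =
      Set.Ico ((l : ℝ) / 2 ^ n) (((l : ℝ) + 1) / 2 ^ n) from hkl, disjoint_self] at this
    exact (hne l).ne_empty this
  refine le_trans ?_ (le_iSup_of_le ((Finset.range (2 ^ n)).image I)
    (le_iSup_of_le ?_ (le_iSup_of_le ?_ le_rfl)))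
  · gcongr
    rw [Finset.sum_image hinj.injOn]
    calc ENNReal.ofReal (1 / 2)
        = ∑ _k ∈ Finset.range (2 ^ n), ENNReal.ofReal (1 / 2 ^ (n + 1)) := by
          rw [← ENNReal.ofReal_sum_of_nonneg fun _ _ => by positivity]
          simp only [Finset.sum_const, Finset.card_range, nsmul_eq_mul]
          congr 1
          push_cast
          rw [pow_succ]
          field_simp
      _ ≤ _ := Finset.sum_le_sum fun k _ => le_EpD_rpow hσ hσp hq hq1 hb hn k
  · intro R hR
    obtain ⟨k, hk, rfl⟩ := Finset.mem_image.1 hR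
    exact Or.inl ⟨n, k, Finset.mem_range.1 hk, rfl⟩
  · intro R hR S hS hRS
    obtain ⟨k, -, rfl⟩ := Finset.mem_image.1 hR
    obtain ⟨l, -, rfl⟩ := Finset.mem_image.1 hS
    exact Ico_dyadic_disjoint n fun h => hRS (h ▸ rfl)

end Variation

lemma fLam_eq_tsum (β : ℝ) (Λ : Set ℕ) :
    fLam β Λ = fun t => ∑' j, Λ.indicator (fun j => ((2 : ℝ) ^ (-β)) ^ j) j * rademacher j t := by
  funext t
  refine tsum_congr fun j => ?_
  by_cases hj : j ∈ Λ
  · simp only [Set.indicator_of_mem hj]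
    rw [← Real.rpow_natCast, ← Real.rpow_mul two_pos.le]
    congr 2
    ring
  · simp [Set.indicator_of_notMem hj]

lemma abs_indicator_pow_le {q : ℝ} (hq : 0 ≤ q) (Λ : Set ℕ) (j : ℕ) :
    |Λ.indicator (fun j => q ^ j) j| ≤ q ^ j := by
  by_cases hj : j ∈ Λ <;> simp [hj, abs_of_nonneg hq, hq]

/-- For `0 < σ < p < ∞` and `β = 1/σ - 1/p`, the functions
`f_Λ = ∑_{j ∈ Λ} 2^{-jβ} r_j` (for `Λ ⊆ {1,2,…}`) satisfy: (1) `|f_Λ|_{V_{σ,p}} ≤ C` with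
a constant `C` independent of `Λ` (so `f_Λ ∈ V_{σ,p}`), and (2) there is `c > 0`,
independent of `Λ, Γ`, such that `|f_Γ - f_Λ|_{V_{σ,p}} ≥ c` whenever `Γ ≠ Λ`. -/
theorem statement11 (σ p : ℝ) (hσ : 0 < σ) (hσp : σ < p) :
    (∃ C : ℝ≥0∞, C ≠ ∞ ∧ ∀ Λ : Set ℕ, Λ ⊆ Set.Ici 1 →
      varD σ p (fLam (1 / σ - 1 / p) Λ) ≤ C ∧
      eLpNorm (fLam (1 / σ - 1 / p) Λ) (ENNReal.ofReal p)
        (volume.restrict (Set.Ico (0 : ℝ) 1)) ≠ ∞) ∧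
    (∃ c : ℝ≥0∞, 0 < c ∧ ∀ Λ Γ : Set ℕ, Λ ⊆ Set.Ici 1 → Γ ⊆ Set.Ici 1 → Γ ≠ Λ →
      c ≤ varD σ p (fLam (1 / σ - 1 / p) Γ - fLam (1 / σ - 1 / p) Λ)) := by
  have hβ : 0 < 1 / σ - 1 / p := sub_pos.2 (one_div_lt_one_div_of_lt hσ hσp)
  obtain ⟨q, hq⟩ : ∃ q : ℝ, q = (2 : ℝ) ^ (-(1 / σ - 1 / p)) := ⟨_, rfl⟩
  have hq0 : 0 < q := hq ▸ by positivity
  have hq1 : q < 1 := hq ▸ Real.rpow_lt_one_of_one_lt_of_neg one_lt_two (by linarith)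
  simp only [fLam_eq_tsum, ← hq]
  refine ⟨⟨ENNReal.ofReal (2 * (1 - q)⁻¹) * 2 ^ (1 / σ - 1 / p),
    ENNReal.mul_ne_top ENNReal.ofReal_ne_top
      (ENNReal.rpow_ne_top_of_nonneg hβ.le ENNReal.ofNat_ne_top), fun Λ _ =>
      ⟨varD_le hσ hσp hq hq1 (abs_indicator_pow_le hq0.le Λ), ?_⟩⟩,
    ENNReal.ofReal (1 / 2) ^ (1 / σ), ?_, ?_⟩
  · refine ne_top_of_le_ne_top ?_ (eLpNorm_le_of_ae_bound (C := (1 - q)⁻¹) (ae_of_all _ fun t =>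
      abs_tsum_rademacher_le hq0.le hq1 (abs_indicator_pow_le hq0.le Λ) t))
    simp
  · exact ENNReal.rpow_pos (by simp) ENNReal.ofReal_ne_top
  · intro Λ Γ hΛ hΓ hne
    have hdiff : ((fun t => ∑' j, Γ.indicator (fun j => q ^ j) j * rademacher j t) -
        fun t => ∑' j, Λ.indicator (fun j => q ^ j) j * rademacher j t) =
        fun t => ∑' j, (Γ.indicator (fun j => q ^ j) j - Λ.indicator (fun j => q ^ j) j) *
          rademacher j t := by
      funext t
      simp only [Pi.sub_apply, sub_mul]
      exact ((summable_rademacher hq0.le hq1 (abs_indicator_pow_le hq0.le Γ) t).tsum_sub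
        (summable_rademacher hq0.le hq1 (abs_indicator_pow_le hq0.le Λ) t)).symm
    rw [hdiff]
    obtain ⟨m, hm⟩ : ∃ m, ¬(m ∈ Γ ↔ m ∈ Λ) := by
      by_contra! h
      exact hne (Set.ext h)
    obtain ⟨n, rfl⟩ : ∃ n, m = n + 1 := by
      refine Nat.exists_eq_succ_of_ne_zero fun h0 => ?_
      subst h0
      have h1 : 0 ∉ Γ := fun h => by simpa using hΓ h
      have h2 : 0 ∉ Λ := fun h => by simpa using hΛ h
      tauto
    refine le_varD (n := n) hσ hσp hq hq1 (fun j => ?_) ?_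
    · by_cases h1 : j ∈ Γ <;> by_cases h2 : j ∈ Λ <;>
        simp [h1, h2, abs_of_nonneg hq0.le, hq0.le]
    · by_cases h1 : n + 1 ∈ Γ <;> by_cases h2 : n + 1 ∈ Λ <;>
        simp [h1, h2, abs_of_nonneg hq0.le] at hm ⊢
end
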